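/- arXiv:0807.2044 — 3 statements merged into one kernel-verified Lean document; each statement's English description precedes it below -/
import Mathlib

section
/- Let A be a finite abelian group and K ⊆ A a subgroup. Then for any prime p, the minimal number of generators of the p-part of the quotient of the annihilator: if φ: A → Hom(A, ℚ/ℤ) is an isomorphism and K^⊥ = {a ∈ A : φ(a)(k) = 0 for all k ∈ K}, then ℓ_p(K^⊥/K') ≥ ℓ_p(A) - 2ℓ_p(K) for any subgroup K' ⊆ K^⊥ with K' ≅ K; in particular ℓ_p(K^⊥/K) ≥ ℓ_p(A) - 2ℓ_p(K) when K ⊆ K^⊥. -/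
/-- The minimal number of generators of an (additive) abelian group. -/
noncomputable def minGen (A : Type*) [AddCommGroup A] : ℕ :=
  sInf {m | ∃ f : Fin m → A, AddSubgroup.closure (Set.range f) = ⊤}

/-- `ℓ_p`: the minimal number of generators of the `p`-primary part. -/
noncomputable def ellp (p : ℕ) [Fact p.Prime] (A : Type*) [AddCommGroup A] : ℕ :=
  minGen (AddCommGroup.primaryComponent A p)

/-- The orthogonal complement `K^⊥ = {a ∈ A : φ(a)(k) = 0 for all k ∈ K}` of a
subgroup `K` of a finite abelian group `A` with respect to a nondegenerate
`ℚ/ℤ`-valued pairing, given by an isomorphism `φ : A ≃ Hom(A, ℚ/ℤ)`. -/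
def perpSub {A : Type*} [AddCommGroup A] (φ : A ≃+ (A →+ AddCircle (1 : ℚ)))
    (K : AddSubgroup A) : AddSubgroup A where
  carrier := {a | ∀ k ∈ K, φ a k = 0}
  zero_mem' := by intro k hk; simp
  add_mem' := by intro a b ha hb k hk; rw [map_add]; simp [ha k hk, hb k hk]
  neg_mem' := by intro a ha k hk; rw [map_neg]; simp [ha k hk]

theorem exists_closure_range_eq_top_minGen (B : Type*) [AddCommGroup B] [Finite B] :
    ∃ f : Fin (minGen B) → B, AddSubgroup.closure (Set.range f) = ⊤ := by
  refine Nat.sInf_mem (s := {m | ∃ f : Fin m → B, AddSubgroup.closure (Set.range f) = ⊤}) ?_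
  obtain ⟨n, ⟨e⟩⟩ := Finite.exists_equiv_fin B
  exact ⟨n, e.symm, by rw [e.symm.surjective.range_eq, AddSubgroup.closure_univ]⟩

theorem minGen_le {B : Type*} [AddCommGroup B] {m : ℕ} (f : Fin m → B)
    (hf : AddSubgroup.closure (Set.range f) = ⊤) : minGen B ≤ m :=
  Nat.sInf_le ⟨f, hf⟩

/-- A subgroup of a `p`-primary torsion group of bounded exponent that spans modulo `p` is
everything. -/
theorem AddSubgroup.eq_top_of_sup_range_nsmul {B : Type*} [AddCommGroup B] {p : ℕ}
    (n : ℕ) (hn : ∀ x : B, p ^ n • x = 0) (S : AddSubgroup B)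
    (hS : ∀ x : B, ∃ s ∈ S, ∃ y, x = s + p • y) : S = ⊤ := by
  have key : ∀ k : ℕ, ∀ x : B, ∃ s ∈ S, ∃ y, x = s + p ^ k • y := by
    intro k
    induction k with
    | zero => exact fun x => ⟨0, S.zero_mem, x, by simp⟩
    | succ k ih =>
      intro x
      obtain ⟨s, hs, y, rfl⟩ := ih x
      obtain ⟨t, ht, z, rfl⟩ := hS y
      refine ⟨s + p ^ k • t, S.add_mem hs (S.nsmul_mem ht _), z, ?_⟩
      rw [smul_add, pow_succ, mul_smul, add_assoc]
  refine (AddSubgroup.eq_top_iff' S).2 fun x => ?_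
  obtain ⟨s, hs, y, rfl⟩ := key n x
  simpa [hn] using hs

/-- Burnside's basis theorem for a finite abelian `p`-group `B`: the minimal number of generators
is the dimension of `B / pB`, here given as a surjection `π` onto a vector space. -/
theorem finrank_eq_minGen (p : ℕ) [Fact p.Prime] {B V : Type*} [AddCommGroup B] [Finite B]
    [AddCommGroup V] [Module (ZMod p) V] [Module.Finite (ZMod p) V]
    (h : ∀ x : B, ∃ k : ℕ, p ^ k • x = 0) (π : B →+ V)
    (hπ : Function.Surjective π) (hker : ∀ x, π x = 0 → ∃ y, p • y = x) :
    Module.finrank (ZMod p) V = minGen B := by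
  apply le_antisymm
  · obtain ⟨f, hf⟩ := exists_closure_range_eq_top_minGen B
    have hg : Submodule.span (ZMod p) (Set.range (π ∘ f)) = ⊤ := by
      refine Submodule.eq_top_iff'.2 fun x => ?_
      obtain ⟨x, rfl⟩ := hπ x
      have hx : x ∈ AddSubgroup.closure (Set.range f) := hf ▸ AddSubgroup.mem_top x
      have hle : AddSubgroup.closure (Set.range f) ≤
          (Submodule.span (ZMod p) (Set.range (π ∘ f))).toAddSubgroup.comap π := by
        rw [AddSubgroup.closure_le]
        rintro _ ⟨i, rfl⟩
        exact Submodule.subset_span ⟨i, rfl⟩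
      exact hle hx
    have := finrank_range_le_card (R := ZMod p) (π ∘ f)
    rwa [Set.finrank, hg, finrank_top, Fintype.card_fin] at this
  · let b := Module.finBasis (ZMod p) V
    choose f hf using fun i => hπ (b i)
    refine minGen_le f ?_
    obtain ⟨n, hn⟩ : ∃ n : ℕ, ∀ x : B, p ^ n • x = 0 := by
      choose k hk using h
      obtain ⟨n, hn⟩ := (Set.finite_range k).bddAbove
      refine ⟨n, fun x => ?_⟩
      obtain ⟨c, hc⟩ := pow_dvd_pow p (hn ⟨x, rfl⟩)
      rw [hc, mul_comm, mul_smul, hk, smul_zero]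
    refine AddSubgroup.eq_top_of_sup_range_nsmul n hn _ fun x => ?_
    have hmap : ∀ y : V, ∃ s ∈ AddSubgroup.closure (Set.range f), π s = y := by
      intro y
      have hy : y ∈ Submodule.span (ZMod p) (Set.range b) := b.span_eq ▸ Submodule.mem_top
      induction hy using Submodule.span_induction with
      | mem _ hz =>
        obtain ⟨i, rfl⟩ := hz
        exact ⟨f i, AddSubgroup.subset_closure ⟨i, rfl⟩, hf i⟩
      | zero => exact ⟨0, AddSubgroup.zero_mem _, map_zero π⟩
      | add _ _ _ _ hu hv =>
        obtain ⟨s, hs, rfl⟩ := hu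
        obtain ⟨t, ht, rfl⟩ := hv
        exact ⟨s + t, AddSubgroup.add_mem _ hs ht, map_add π s t⟩
      | smul a _ _ hu =>
        obtain ⟨s, hs, rfl⟩ := hu
        refine ⟨a.val • s, AddSubgroup.nsmul_mem _ hs _, ?_⟩
        rw [map_nsmul, ← Nat.cast_smul_eq_nsmul (ZMod p), ZMod.natCast_zmod_val]
    obtain ⟨s, hs, hsx⟩ := hmap (π x)
    obtain ⟨y, hy⟩ := hker (x - s) (by rw [map_sub, hsx, sub_self])
    exact ⟨s, hs, y, by rw [hy, add_sub_cancel]⟩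

theorem card_eq_pow_minGen (p : ℕ) [Fact p.Prime] {B V : Type*} [AddCommGroup B] [Finite B]
    [AddCommGroup V] (hV : ∀ x : V, p • x = 0) (h : ∀ x : B, ∃ k : ℕ, p ^ k • x = 0) (π : B →+ V)
    (hπ : Function.Surjective π) (hker : ∀ x, π x = 0 → ∃ y, p • y = x) :
    Nat.card V = p ^ minGen B := by
  have : Finite V := Finite.of_surjective π hπ
  have : Module (ZMod p) V := AddCommGroup.zmodModule hV
  have : Module.Finite (ZMod p) V := Module.Finite.of_finite
  rw [← finrank_eq_minGen p h π hπ hker, Module.natCard_eq_pow_finrank (K := ZMod p),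
    Nat.card_zmod]

/-- For a finite abelian `p`-group `B` one has `|B[p]| = p ^ d`, with `d` the minimal number of
generators. -/
theorem card_ker_nsmul_eq_pow_minGen (p : ℕ) [Fact p.Prime] (B : Type*) [AddCommGroup B]
    [Finite B] (h : ∀ x : B, ∃ k : ℕ, p ^ k • x = 0) :
    Nat.card (nsmulAddMonoidHom p : B →+ B).ker = p ^ minGen B := by
  set R := (nsmulAddMonoidHom p : B →+ B).range
  have hcard : Nat.card (nsmulAddMonoidHom p : B →+ B).ker = Nat.card (B ⧸ R) := by
    have h1 := (nsmulAddMonoidHom p : B →+ B).ker.card_mul_index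
    have h2 := R.card_mul_index
    rw [AddSubgroup.index_ker, mul_comm, ← h2] at h1
    exact Nat.eq_of_mul_eq_mul_left Nat.card_pos h1
  have hp : ∀ x : B ⧸ R, p • x = 0 := by
    intro x
    induction x using QuotientAddGroup.induction_on with
    | H x => exact (QuotientAddGroup.eq_zero_iff (p • x)).2 ⟨x, rfl⟩
  rw [hcard]
  exact card_eq_pow_minGen p hp h (QuotientAddGroup.mk' R) (QuotientAddGroup.mk'_surjective R)
    fun x hx => (QuotientAddGroup.eq_zero_iff x).1 hx

theorem card_ker_nsmul_eq_pow_ellp (p : ℕ) [Fact p.Prime] (A : Type*) [AddCommGroup A]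
    [Finite A] : Nat.card (nsmulAddMonoidHom p : A →+ A).ker = p ^ ellp p A := by
  rw [ellp, ← card_ker_nsmul_eq_pow_minGen p]
  · refine Nat.card_congr
      { toFun := fun x => ⟨⟨x, 1, by rw [pow_one]; exact x.2⟩, Subtype.ext x.2⟩
        invFun := fun x => ⟨x.1, congrArg Subtype.val (show p • x.1 = 0 from x.2)⟩
        left_inv := fun _ => rfl
        right_inv := fun _ => rfl }
  · rintro ⟨x, k, hk⟩
    exact ⟨k, Subtype.ext hk⟩

theorem card_ker_nsmul_le_mul {G H : Type*} [AddCommGroup G] [AddCommGroup H] [Finite G] (n : ℕ)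
    [Finite (nsmulAddMonoidHom n : H →+ H).ker] (f : G →+ H) :
    Nat.card (nsmulAddMonoidHom n : G →+ G).ker ≤
      Nat.card (nsmulAddMonoidHom n : f.ker →+ f.ker).ker *
        Nat.card (nsmulAddMonoidHom n : H →+ H).ker := by
  let g : (nsmulAddMonoidHom n : G →+ G).ker →+ (nsmulAddMonoidHom n : H →+ H).ker :=
    (f.comp (AddSubgroup.subtype _)).codRestrict _ fun x => by
      have hx : n • (x : G) = 0 := x.2
      change n • f x = 0
      rw [← map_nsmul, hx, map_zero]
  have hmem : ∀ x : g.ker, f (x : (nsmulAddMonoidHom n : G →+ G).ker) = 0 :=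
    fun x => congrArg Subtype.val (show g x = 0 from x.2)
  rw [← g.ker.card_mul_index, AddSubgroup.index_ker]
  refine Nat.mul_le_mul ?_ (Nat.card_le_card_of_injective _ Subtype.val_injective)
  refine Nat.card_le_card_of_injective
    (fun x => ⟨⟨(x : (nsmulAddMonoidHom n : G →+ G).ker), hmem x⟩, Subtype.ext x.1.2⟩) ?_
  intro x y hxy
  exact Subtype.ext (Subtype.ext (congrArg (fun z => (z.1.1 : G)) hxy))

theorem ellp_congr (p : ℕ) [Fact p.Prime] {A B : Type*} [AddCommGroup A] [AddCommGroup B]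
    [Finite A] [Finite B] (e : A ≃+ B) : ellp p A = ellp p B := by
  apply Nat.pow_right_injective (Fact.out : p.Prime).two_le
  change p ^ ellp p A = p ^ ellp p B
  rw [← card_ker_nsmul_eq_pow_ellp, ← card_ker_nsmul_eq_pow_ellp]
  refine Nat.card_congr (e.toEquiv.subtypeEquiv fun x => ?_)
  change p • x = 0 ↔ p • e x = 0
  rw [← map_nsmul, EmbeddingLike.map_eq_zero_iff]

theorem card_ker_nsmul_addCircle_le (n : ℕ) (hn : 0 < n) :
    Finite (nsmulAddMonoidHom n : AddCircle (1 : ℚ) →+ AddCircle (1 : ℚ)).ker ∧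
      Nat.card (nsmulAddMonoidHom n : AddCircle (1 : ℚ) →+ AddCircle (1 : ℚ)).ker ≤ n := by
  have : Fact ((0 : ℚ) < 1) := ⟨one_pos⟩
  choose m hm hmx using fun x : (nsmulAddMonoidHom n :
    AddCircle (1 : ℚ) →+ AddCircle (1 : ℚ)).ker => (AddCircle.nsmul_eq_zero_iff hn).1 x.2
  have hinj : Function.Injective fun x => (⟨m x, hm x⟩ : Fin n) := by
    intro x y hxy
    have : m x = m y := congrArg Fin.val hxy
    exact Subtype.ext (by rw [← hmx x, ← hmx y, this])
  exact ⟨Finite.of_injective _ hinj, by simpa using Nat.card_le_card_of_injective _ hinj⟩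

/-- A character of `K` killed by `p` is determined by its values on generators of the `p`-primary
part of `K`. -/
theorem card_ker_nsmul_addCircle_hom_le (p : ℕ) [hp : Fact p.Prime] (K : Type*) [AddCommGroup K]
    [Finite K] :
    Finite (nsmulAddMonoidHom p : (K →+ AddCircle (1 : ℚ)) →+ (K →+ AddCircle (1 : ℚ))).ker ∧
      Nat.card (nsmulAddMonoidHom p : (K →+ AddCircle (1 : ℚ)) →+
        (K →+ AddCircle (1 : ℚ))).ker ≤ p ^ ellp p K := by
  obtain ⟨hfin, hle⟩ := card_ker_nsmul_addCircle_le p hp.out.pos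
  obtain ⟨f, hf⟩ := exists_closure_range_eq_top_minGen (AddCommGroup.primaryComponent K p)
  have hker : ∀ χ : (nsmulAddMonoidHom p : (K →+ AddCircle (1 : ℚ)) →+
      (K →+ AddCircle (1 : ℚ))).ker, ∀ k : K, p • χ.1 k = 0 := fun χ k =>
    DFunLike.congr_fun (show p • χ.1 = 0 from χ.2) k
  let ev : (nsmulAddMonoidHom p : (K →+ AddCircle (1 : ℚ)) →+ (K →+ AddCircle (1 : ℚ))).ker →
      (Fin (ellp p K) → (nsmulAddMonoidHom p : AddCircle (1 : ℚ) →+ AddCircle (1 : ℚ)).ker) :=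
    fun χ i => ⟨χ.1 (f i), hker χ _⟩
  have hev : Function.Injective ev := by
    intro χ ψ hχψ
    have hprim : χ.1.comp (AddSubgroup.subtype (AddCommGroup.primaryComponent K p)) =
        ψ.1.comp (AddSubgroup.subtype _) := by
      refine AddMonoidHom.eq_of_eqOn_dense hf ?_
      rintro _ ⟨i, rfl⟩
      exact congrArg Subtype.val (congrFun hχψ i)
    refine Subtype.ext (AddMonoidHom.ext fun k => ?_)
    obtain ⟨e, n, hn, hk⟩ := Nat.exists_eq_pow_mul_and_not_dvd (addOrderOf_pos k).ne' p
      hp.out.ne_one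
    have hmem : n • k ∈ AddCommGroup.primaryComponent K p :=
      ⟨e, by rw [← mul_smul, ← hk, addOrderOf_nsmul_eq_zero]⟩
    have h1 : n • (χ.1 k - ψ.1 k) = 0 := by
      rw [smul_sub, ← map_nsmul, ← map_nsmul, sub_eq_zero]
      exact DFunLike.congr_fun hprim ⟨n • k, hmem⟩
    have h2 : p • (χ.1 k - ψ.1 k) = 0 := by rw [smul_sub, hker, hker, sub_zero]
    have hdvd := Nat.dvd_gcd (addOrderOf_dvd_of_nsmul_eq_zero h2)
      (addOrderOf_dvd_of_nsmul_eq_zero h1)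
    rw [((Nat.Prime.coprime_iff_not_dvd hp.out).2 hn).gcd_eq_one, Nat.dvd_one,
      AddMonoid.addOrderOf_eq_one_iff] at hdvd
    exact sub_eq_zero.1 hdvd
  refine ⟨Finite.of_injective _ hev, (Nat.card_le_card_of_injective _ hev).trans ?_⟩
  rw [Nat.card_fun, Nat.card_fin]
  exact Nat.pow_le_pow_left hle _

theorem ellp_le_ellp_quotient_add (p : ℕ) [hp : Fact p.Prime] (A : Type*) [AddCommGroup A]
    [Finite A] (φ : A ≃+ (A →+ AddCircle (1 : ℚ))) (K K' : AddSubgroup A)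
    (hK' : K' ≤ perpSub φ K) (e : K' ≃+ K) :
    ellp p A ≤ ellp p (↥(perpSub φ K) ⧸ K'.addSubgroupOf (perpSub φ K)) + 2 * ellp p ↥K := by
  obtain ⟨hfin, hle⟩ := card_ker_nsmul_addCircle_hom_le p K
  let r : A →+ (K →+ AddCircle (1 : ℚ)) :=
    (AddMonoidHom.compHom.flip K.subtype).comp φ.toAddMonoidHom
  have hr : r.ker = perpSub φ K := by
    ext a
    exact ⟨fun h k hk => DFunLike.congr_fun (show r a = 0 from h) ⟨k, hk⟩,
      fun h => AddMonoidHom.ext fun k => h k k.2⟩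
  have h1 := card_ker_nsmul_le_mul p r
  rw [hr] at h1
  have h2 := card_ker_nsmul_le_mul p (QuotientAddGroup.mk' (K'.addSubgroupOf (perpSub φ K)))
  rw [QuotientAddGroup.ker_mk'] at h2
  simp only [card_ker_nsmul_eq_pow_ellp] at h1 h2
  rw [ellp_congr p ((AddSubgroup.addSubgroupOfEquivOfLe hK').trans e)] at h2
  rw [← Nat.pow_le_pow_iff_right hp.out.one_lt]
  calc _ ≤ _ := h1
    _ ≤ _ := Nat.mul_le_mul h2 hle
    _ = _ := by ring

/-- Let `A` be a finite abelian group, `φ : A ≃ Hom(A, ℚ/ℤ)` an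
isomorphism, `K ⊆ A` a subgroup and `K^⊥` its annihilator.  Then for any prime
`p` and any subgroup `K' ⊆ K^⊥` with `K' ≅ K` one has
`ℓ_p(K^⊥/K') ≥ ℓ_p(A) - 2 ℓ_p(K)`; in particular `ℓ_p(K^⊥/K) ≥ ℓ_p(A) - 2 ℓ_p(K)`
when `K ⊆ K^⊥`. -/
theorem stmt_9 (p : ℕ) [Fact p.Prime] (A : Type*) [AddCommGroup A] [Finite A]
    (φ : A ≃+ (A →+ AddCircle (1 : ℚ))) (K : AddSubgroup A) :
    (∀ K' : AddSubgroup A, K' ≤ perpSub φ K → Nonempty (↥K' ≃+ ↥K) →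
      ellp p A ≤ ellp p (↥(perpSub φ K) ⧸ K'.addSubgroupOf (perpSub φ K)) + 2 * ellp p ↥K) ∧
    (K ≤ perpSub φ K →
      ellp p A ≤ ellp p (↥(perpSub φ K) ⧸ K.addSubgroupOf (perpSub φ K)) + 2 * ellp p ↥K) := by
  exact ⟨fun K' hK' ⟨e⟩ => ellp_le_ellp_quotient_add p A φ K K' hK' e,
    fun hK => ellp_le_ellp_quotient_add p A φ K K hK (AddEquiv.refl _)⟩
end

section
/- Let p be a prime and L ⊃ S a p-unimodular extension of a nondegenerate lattice S (i.e., S is a sublattice of the nondegenerate lattice L with det L prime to p). Let S̃ be the primitive hull of S in L and K the kernel of the finite-index extension S̃ ⊃ S. Then rank of the orthogonal complement S^⊥ in L satisfies rank S^⊥ ≥ ℓ_p(discr S) - 2 ℓ_p(K). -/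
open LinearMap

variable {n : ℕ}

/-- A rational number is an integer. -/
def IsIntQ (q : ℚ) : Prop := ∃ m : ℤ, q = (m : ℚ)

/-- Integrality of a bilinear form on a `ℤ`-submodule: the lattice condition. -/
def IsIntegralLat (B : LinearMap.BilinForm ℚ (Fin n → ℚ)) (S : Submodule ℤ (Fin n → ℚ)) :
    Prop := ∀ x ∈ S, ∀ y ∈ S, IsIntQ (B x y)

/-- The dual lattice `S* = {x ∈ V : B(x,S) ⊆ ℤ}` of a `ℤ`-submodule `S` of `V = ℚⁿ`. -/
def dualLat (B : LinearMap.BilinForm ℚ (Fin n → ℚ)) (S : Submodule ℤ (Fin n → ℚ)) :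
    Submodule ℤ (Fin n → ℚ) where
  carrier := {x | ∀ s ∈ S, IsIntQ (B x s)}
  zero_mem' := fun s _ => ⟨0, by simp⟩
  add_mem' := by
    rintro x y hx hy s hs
    obtain ⟨a, ha⟩ := hx s hs
    obtain ⟨b, hb⟩ := hy s hs
    exact ⟨a + b, by simp [map_add, ha, hb]⟩
  smul_mem' := by
    rintro c x hx s hs
    obtain ⟨a, ha⟩ := hx s hs
    refine ⟨c * a, ?_⟩
    have : B (c • x) s = c • (B x s) := by
      rw [map_zsmul]
      rfl
    rw [this, ha, zsmul_eq_mul]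
    push_cast
    ring
  
/-- The orthogonal complement (in `V`) of a `ℤ`-submodule. -/
def orthLat (B : LinearMap.BilinForm ℚ (Fin n → ℚ)) (S : Submodule ℤ (Fin n → ℚ)) :
    Submodule ℤ (Fin n → ℚ) where
  carrier := {x | ∀ s ∈ S, B x s = 0}
  zero_mem' := fun s _ => by simp
  add_mem' := by
    rintro x y hx hy s hs
    simp [map_add, hx s hs, hy s hs]
  smul_mem' := by
    rintro c x hx s hs
    have h : B (c • x) s = c • (B x s) := by rw [map_zsmul]; rfl
    exact h.trans (by simp [hx s hs])

/-- The quotient `T / (S ∩ T)` of one `ℤ`-submodule of `V` by another. -/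
abbrev quotIn (T S : Submodule ℤ (Fin n → ℚ)) : Type :=
  T ⧸ (S.comap T.subtype)

/-- The discriminant group `discr S = S*/S`. -/
abbrev discrGrp (B : LinearMap.BilinForm ℚ (Fin n → ℚ)) (S : Submodule ℤ (Fin n → ℚ)) :
    Type := quotIn (dualLat B S) S

/-- The class in `discr S` of an element of the dual lattice. -/
abbrev discrCls (B : LinearMap.BilinForm ℚ (Fin n → ℚ)) (S : Submodule ℤ (Fin n → ℚ))
    (x : ↥(dualLat B S)) : discrGrp B S :=
  (S.comap (dualLat B S).subtype).mkQ x

/-- The kernel `K = M/S ⊆ discr S` of a finite-index extension `M ⊃ S`. -/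
abbrev extKer (B : LinearMap.BilinForm ℚ (Fin n → ℚ)) (S M : Submodule ℤ (Fin n → ℚ)) :
    Submodule ℤ (discrGrp B S) :=
  (M.comap (dualLat B S).subtype).map (S.comap (dualLat B S).subtype).mkQ

lemma AddCommGroup.card_torsion_eq_card_quotient (p : ℕ) (A : Type*) [AddCommGroup A] [Finite A] :
    Nat.card {a : A // p • a = 0} = Nat.card (A ⧸ (nsmulAddMonoidHom (α := A) p).range) := by
  set f := nsmulAddMonoidHom (α := A) p
  have h1 := AddSubgroup.card_eq_card_quotient_mul_card_addSubgroup f.range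
  have h2 := AddSubgroup.card_eq_card_quotient_mul_card_addSubgroup f.ker
  rw [Nat.card_congr (QuotientAddGroup.quotientKerEquivRange f).toEquiv, mul_comm] at h2
  have h3 : Nat.card f.ker = Nat.card (A ⧸ f.range) :=
    Nat.eq_of_mul_eq_mul_right Nat.card_pos (h2.symm.trans h1)
  exact h3

lemma AddSubgroup.eq_top_of_sup_nsmul_range (p : ℕ) {A : Type*} [AddCommGroup A] [Finite A]
    (hA : ∀ a : A, ∃ k : ℕ, p ^ k • a = 0) (H : AddSubgroup A)
    (hH : ∀ a : A, ∃ h ∈ H, ∃ b : A, a = h + p • b) : H = ⊤ := by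
  have hsurj : Function.Surjective (fun q : A ⧸ H => p • q) := by
    intro q
    induction q using QuotientAddGroup.induction_on with
    | H a =>
      obtain ⟨h, hh, b, rfl⟩ := hH a
      refine ⟨(b : A ⧸ H), ?_⟩
      have : ((h : A) : A ⧸ H) = 0 := (QuotientAddGroup.eq_zero_iff h).2 hh
      simp [this]
  have hinj : Function.Injective (fun q : A ⧸ H => p • q) :=
    Finite.injective_iff_surjective.2 hsurj
  have hpow : ∀ (k : ℕ) (q : A ⧸ H), p ^ k • q = 0 → q = 0 := by
    intro k
    induction k with
    | zero => intro q hq; simpa using hq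
    | succ k ih =>
      intro q hq
      refine ih q (hinj ?_)
      simpa [← mul_smul, ← pow_succ'] using hq
  refine eq_top_iff.2 fun a _ => ?_
  obtain ⟨k, hk⟩ := hA a
  refine (QuotientAddGroup.eq_zero_iff a).1 (hpow k _ ?_)
  rw [← QuotientAddGroup.mk_nsmul, hk, QuotientAddGroup.mk_zero]

/-- Burnside's basis theorem for finite abelian `p`-groups. -/
lemma minGen_eq_finrank (p : ℕ) [Fact p.Prime] {A Q : Type*} [AddCommGroup A] [Finite A]
    (hA : ∀ a : A, ∃ k : ℕ, p ^ k • a = 0) [AddCommGroup Q] [Module (ZMod p) Q]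
    (π : A →+ Q) (hπ : Function.Surjective π) (hker : ∀ a, π a = 0 → ∃ b, p • b = a) :
    minGen A = Module.finrank (ZMod p) Q := by
  have : Finite Q := Finite.of_surjective π hπ
  set d := Module.finrank (ZMod p) Q
  have hd : ∃ f : Fin d → A, AddSubgroup.closure (Set.range f) = ⊤ := by
    let b := Module.finBasis (ZMod p) Q
    choose f hf using fun i => hπ (b i)
    refine ⟨f, AddSubgroup.eq_top_of_sup_nsmul_range p hA _ fun a => ?_⟩
    set h := ∑ i, (b.repr (π a) i).val • f i with hh
    have hmem : h ∈ AddSubgroup.closure (Set.range f) :=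
      sum_mem fun i _ => nsmul_mem (AddSubgroup.subset_closure (Set.mem_range_self i)) _
    have heq : π h = π a := by
      rw [← b.sum_repr (π a), hh, map_sum]
      refine Finset.sum_congr rfl fun i _ => ?_
      rw [map_nsmul, hf, ← Nat.cast_smul_eq_nsmul (ZMod p), ZMod.natCast_zmod_val]
    obtain ⟨c, hc⟩ := hker (a - h) (by rw [map_sub, heq, sub_self])
    exact ⟨h, hmem, c, by rw [hc]; abel⟩
  refine le_antisymm (Nat.sInf_le hd) (le_csInf ⟨d, hd⟩ ?_)
  rintro m ⟨f, hf⟩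
  have hspan : Submodule.span (ZMod p) (Set.range fun i => π (f i)) = ⊤ := by
    rw [eq_top_iff]
    rintro q -
    obtain ⟨a, rfl⟩ := hπ q
    have hle : AddSubgroup.closure (Set.range f) ≤
        (Submodule.span (ZMod p) (Set.range fun i => π (f i))).toAddSubgroup.comap π := by
      rw [AddSubgroup.closure_le]
      rintro _ ⟨i, rfl⟩
      exact Submodule.subset_span ⟨i, rfl⟩
    exact hle (hf ▸ AddSubgroup.mem_top a)
  exact (finrank_le_of_span_eq_top hspan).trans_eq (Fintype.card_fin m)

/-- For a finite abelian `p`-group the minimal number of generators is the dimension of the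
`p`-torsion. -/
lemma pow_minGen_eq_card_torsion (p : ℕ) [Fact p.Prime] (A : Type*) [AddCommGroup A] [Finite A]
    (hA : ∀ a : A, ∃ k : ℕ, p ^ k • a = 0) :
    p ^ minGen A = Nat.card {a : A // p • a = 0} := by
  let R := (nsmulAddMonoidHom (α := A) p).range
  let : Module (ZMod p) (A ⧸ R) := QuotientAddGroup.zmodModule fun x => ⟨x, rfl⟩
  rw [AddCommGroup.card_torsion_eq_card_quotient, ← FiniteField.pow_finrank_eq_natCard p (A ⧸ R),
    minGen_eq_finrank p hA (QuotientAddGroup.mk' R) (QuotientAddGroup.mk'_surjective R)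
      fun a ha => (QuotientAddGroup.eq_zero_iff a).1 ha]

lemma LinearMap.finrank_ker_comp_le {F U V W : Type*} [Field F] [AddCommGroup U] [AddCommGroup V]
    [AddCommGroup W] [Module F U] [Module F V] [Module F W] [FiniteDimensional F U]
    [FiniteDimensional F V] (g : V →ₗ[F] W) (f : U →ₗ[F] V) :
    Module.finrank F (ker (g ∘ₗ f)) ≤ Module.finrank F (ker f) + Module.finrank F (ker g) := by
  let h : ker (g ∘ₗ f) →ₗ[F] ker g := (f.domRestrict (ker (g ∘ₗ f))).codRestrict (ker g) fun x => x.2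
  have h1 := h.finrank_range_add_finrank_ker
  have h2 : Module.finrank F (ker h) ≤ Module.finrank F (ker f) := by
    refine LinearMap.finrank_le_finrank_of_injective
      (f := ((ker (g ∘ₗ f)).subtype ∘ₗ (ker h).subtype).codRestrict (ker f) ?_) ?_
    · rintro ⟨x, hx⟩
      exact congrArg Subtype.val hx
    · intro x y hxy
      exact Subtype.ext (Subtype.ext (congrArg (Subtype.val : ker f → U) hxy))
  have h3 := Submodule.finrank_le (range h)
  omega

open scoped Matrix in
/-- A Sylvester-type bound for the corank of a congruence transform `A * G * Aᵀ` of an injective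
matrix `G`. -/
lemma Matrix.finrank_ker_mul_mul_transpose_le {F : Type*} [Field F] {s m : ℕ}
    (A : Matrix (Fin s) (Fin m) F) (G : Matrix (Fin m) (Fin m) F)
    (hG : ∀ w, G.mulVec w = 0 → w = 0) :
    Module.finrank F (ker (A * G * Aᵀ).mulVecLin) + s ≤
      m + 2 * Module.finrank F (ker Aᵀ.mulVecLin) := by
  have hGker : ker G.mulVecLin = ⊥ := (LinearMap.ker_eq_bot').2 hG
  have h1 := LinearMap.finrank_ker_comp_le A.mulVecLin (G.mulVecLin ∘ₗ Aᵀ.mulVecLin)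
  have h2 := LinearMap.finrank_ker_comp_le G.mulVecLin Aᵀ.mulVecLin
  rw [hGker, finrank_bot] at h2
  rw [← Matrix.mulVecLin_mul, ← Matrix.mulVecLin_mul, ← Matrix.mul_assoc] at h1
  rw [← Matrix.mulVecLin_mul] at h2
  have h3 := A.mulVecLin.finrank_range_add_finrank_ker
  have h4 := Aᵀ.mulVecLin.finrank_range_add_finrank_ker
  have h5 : Aᵀ.rank = A.rank := A.rank_transpose
  simp only [Matrix.rank, Module.finrank_fin_fun] at h3 h4 h5
  omega

/-- A `ℤ`-submodule is finitely generated if it is separated by finitely many integer-valued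
pairings. -/
lemma Submodule.fg_of_integral_pairing (B : LinearMap.BilinForm ℚ (Fin n → ℚ))
    (T : Submodule ℤ (Fin n → ℚ)) {ι : Type*} [Finite ι] (v : ι → Fin n → ℚ)
    (hint : ∀ x ∈ T, ∀ i, IsIntQ (B x (v i)))
    (hsep : ∀ x ∈ T, (∀ i, B x (v i) = 0) → x = 0) : T.FG := by
  choose f hf using fun x : T => hint x x.2
  let φ : T →+ (ι → ℤ) := AddMonoidHom.mk' f fun x y => by
    ext i
    have := hf (x + y) i
    simp only [Submodule.coe_add, map_add, LinearMap.add_apply, hf] at this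
    exact_mod_cast this.symm
  have hφ : Function.Injective φ.toIntLinearMap := by
    refine (injective_iff_map_eq_zero φ).2 fun x hx => Subtype.ext (hsep x x.2 fun i => ?_)
    rw [hf x i, show f x i = 0 from congrFun hx i, Int.cast_zero]
  exact Module.Finite.iff_fg.1 (Module.Finite.of_injective _ hφ)

/-- A lattice on which a nondegenerate form is integral is finitely generated. -/
lemma IsIntegralLat.fg {B : LinearMap.BilinForm ℚ (Fin n → ℚ)} (hnd : B.Nondegenerate)
    {L : Submodule ℤ (Fin n → ℚ)} (hLspan : Submodule.span ℚ (L : Set (Fin n → ℚ)) = ⊤)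
    (hlat : IsIntegralLat B L) : L.FG := by
  obtain ⟨t, htL, ht⟩ := Submodule.fg_span_iff_fg_span_finset_subset (R := ℚ)
    (L : Set (Fin n → ℚ)) |>.1 (IsNoetherian.noetherian _)
  refine Submodule.fg_of_integral_pairing B L (fun v : t => (v : Fin n → ℚ))
    (fun x hx v => hlat x hx v (htL v.2)) fun x _ h => hnd.1 x fun y => ?_
  have hy : y ∈ Submodule.span ℚ (t : Set (Fin n → ℚ)) := by rw [← ht, hLspan]; trivial
  have hle : Submodule.span ℚ (t : Set (Fin n → ℚ)) ≤ ker (B x) :=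
    Submodule.span_le.2 fun v hv => h ⟨v, hv⟩
  exact hle hy

lemma Submodule.FG.exists_linearIndependent_span_eq {T : Submodule ℤ (Fin n → ℚ)} (hT : T.FG) :
    ∃ (s : ℕ) (e : Fin s → Fin n → ℚ),
      LinearIndependent ℤ e ∧ Submodule.span ℤ (Set.range e) = T := by
  have : Module.Finite ℤ T := Module.Finite.iff_fg.2 hT
  let b := Module.finBasis ℤ T
  refine ⟨_, T.subtype ∘ b, b.linearIndependent.map' _ T.ker_subtype, ?_⟩
  rw [Set.range_comp, ← Submodule.map_span, b.span_eq, Submodule.map_subtype_top]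

lemma LinearIndependent.dvd_of_sum_smul_eq {s : ℕ} {e : Fin s → Fin n → ℚ}
    (he : LinearIndependent ℤ e) {p : ℤ} {u : Fin s → ℤ} {y : Fin n → ℚ}
    (hy : y ∈ Submodule.span ℤ (Set.range e)) (h : ∑ i, u i • e i = p • y) (i : Fin s) :
    p ∣ u i := by
  obtain ⟨w, rfl⟩ := (Submodule.mem_span_range_iff_exists_fun ℤ).1 hy
  have := Fintype.linearIndependent_iff.1 he (fun i => u i - p * w i) (by
    simp only [sub_smul, Finset.sum_sub_distrib, mul_smul, ← Finset.smul_sum, h, sub_self]) i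
  exact ⟨w i, by linarith⟩

lemma finite_primaryComponent_discrGrp (p : ℕ) [Fact p.Prime]
    {B : LinearMap.BilinForm ℚ (Fin n → ℚ)} {S : Submodule ℤ (Fin n → ℚ)} (hS : S.FG)
    (hSnd : ∀ x ∈ Submodule.span ℚ (S : Set (Fin n → ℚ)), (∀ y ∈ S, B x y = 0) → x = 0) :
    Finite (AddCommGroup.primaryComponent (discrGrp B S) p) := by
  obtain ⟨t, ht⟩ := hS
  set T : Submodule ℤ (Fin n → ℚ) :=
    (Submodule.span ℚ (S : Set (Fin n → ℚ))).restrictScalars ℤ ⊓ dualLat B S with hTdef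
  have hT : T.FG := by
    refine Submodule.fg_of_integral_pairing B T (fun v : t => (v : Fin n → ℚ))
      (fun x hx v => hx.2 v (ht ▸ Submodule.subset_span v.2)) fun x hx h => hSnd x hx.1 ?_
    have hle : S ≤ (ker (B x)).restrictScalars ℤ := by
      rw [← ht]
      exact Submodule.span_le.2 fun v hv => h ⟨v, hv⟩
    exact fun y hy => hle hy
  have hT' : (T.comap (dualLat B S).subtype).FG := by
    refine Submodule.fg_of_fg_map_injective _ (dualLat B S).injective_subtype ?_
    rwa [Submodule.map_comap_subtype, inf_eq_right.2 inf_le_right]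
  have hR := hT'.map (S.comap (dualLat B S).subtype).mkQ
  set P := AddSubgroup.toIntSubmodule (AddCommGroup.primaryComponent (discrGrp B S) p) with hP
  have hp0 : p ≠ 0 := (Fact.out : p.Prime).ne_zero
  have hPR : P ≤ (T.comap (dualLat B S).subtype).map (S.comap (dualLat B S).subtype).mkQ := by
    rintro q ⟨k, hk⟩
    obtain ⟨x, rfl⟩ := Submodule.mkQ_surjective _ q
    have hx : p ^ k • (x : Fin n → ℚ) ∈ S := by
      rw [← map_nsmul] at hk
      simpa using (Submodule.Quotient.mk_eq_zero _).1 hk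
    refine ⟨x, ⟨?_, x.2⟩, rfl⟩
    have hmem := Submodule.smul_mem (Submodule.span ℚ (S : Set (Fin n → ℚ))) ((p ^ k : ℚ)⁻¹)
      (Submodule.subset_span hx)
    rw [← Nat.cast_smul_eq_nsmul ℚ, Nat.cast_pow, smul_smul, inv_mul_cancel₀ (by positivity),
      one_smul] at hmem
    exact hmem
  have : Module.Finite ℤ P := Module.Finite.iff_fg.2 (hR.of_le hPR)
  refine Module.finite_of_fg_torsion P fun {x} => ?_
  obtain ⟨k, hk⟩ := x.2
  refine ⟨⟨(p : ℤ) ^ k, mem_nonZeroDivisors_of_ne_zero (by positivity)⟩, Subtype.ext ?_⟩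
  have : ((p : ℤ) ^ k) • (x : discrGrp B S) = 0 := by
    rw [← Nat.cast_pow, natCast_zsmul]; exact hk
  exact this

/-- The orthogonal complement of a sublattice spanned by `s` vectors has rank at least `n - s`. -/
lemma le_add_finrank_span_inf_orthLat (B : LinearMap.BilinForm ℚ (Fin n → ℚ))
    {S L : Submodule ℤ (Fin n → ℚ)}
    (hLspan : Submodule.span ℚ (L : Set (Fin n → ℚ)) = ⊤)
    {s : ℕ} {e : Fin s → Fin n → ℚ} (he : Submodule.span ℤ (Set.range e) = S) :
    n ≤ s + Module.finrank ℚ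
      (Submodule.span ℚ ((L ⊓ orthLat B S : Submodule ℤ (Fin n → ℚ)) : Set (Fin n → ℚ))) := by
  let φ : (Fin n → ℚ) →ₗ[ℚ] (Fin s → ℚ) := LinearMap.pi fun i => B.flip (e i)
  have h1 := φ.finrank_range_add_finrank_ker
  have h2 := Submodule.finrank_le (range φ)
  rw [Module.finrank_fin_fun] at h1 h2
  have h3 : ker φ ≤
      Submodule.span ℚ ((L ⊓ orthLat B S : Submodule ℤ (Fin n → ℚ)) : Set (Fin n → ℚ)) := by
    intro x hx
    have hmul : ∃ N : ℤ, N ≠ 0 ∧ N • x ∈ L := by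
      have hx' : x ∈ Submodule.span ℚ (L : Set (Fin n → ℚ)) := by rw [hLspan]; trivial
      clear hx
      induction hx' using Submodule.span_induction with
      | mem x h => exact ⟨1, one_ne_zero, by simpa using h⟩
      | zero => exact ⟨1, one_ne_zero, by simp⟩
      | add x y _ _ hx hy =>
        obtain ⟨N, hN, hNx⟩ := hx
        obtain ⟨M, hM, hMy⟩ := hy
        refine ⟨N * M, mul_ne_zero hN hM, ?_⟩
        rw [smul_add]
        refine L.add_mem ?_ ?_
        · rw [mul_comm, mul_smul]; exact L.smul_mem M hNx
        · rw [mul_smul]; exact L.smul_mem N hMy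
      | smul a x _ hx =>
        obtain ⟨N, hN, hNx⟩ := hx
        refine ⟨a.den * N, mul_ne_zero (by exact_mod_cast a.den_ne_zero) hN, ?_⟩
        have : ((a.den : ℤ) * N) • a • x = a.num • N • x := by
          simp only [← Int.cast_smul_eq_zsmul ℚ, smul_smul]
          congr 1
          push_cast
          rw [← Rat.mul_den_eq_num a]
          ring
        rw [this]
        exact L.smul_mem _ hNx
    obtain ⟨N, hN, hNx⟩ := hmul
    have horth : N • x ∈ orthLat B S := by
      refine Submodule.smul_mem _ _ ?_
      have hle : S ≤ (ker (B x)).restrictScalars ℤ := by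
        rw [← he, Submodule.span_le]
        rintro _ ⟨i, rfl⟩
        exact congrFun (LinearMap.mem_ker.1 hx) i
      exact fun y hy => hle hy
    have hmem := Submodule.smul_mem (Submodule.span ℚ
      ((L ⊓ orthLat B S : Submodule ℤ (Fin n → ℚ)) : Set (Fin n → ℚ))) ((N : ℚ)⁻¹)
      (Submodule.subset_span ⟨hNx, horth⟩)
    rwa [← Int.cast_smul_eq_zsmul ℚ, smul_smul, inv_mul_cancel₀ (by exact_mod_cast hN),
      one_smul] at hmem
  have h4 := Submodule.finrank_mono h3
  omega

lemma LinearMap.apply_sum_zsmul (f : (Fin n → ℚ) →ₗ[ℚ] ℚ) {m : ℕ} (u : Fin m → ℤ)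
    {c : Fin m → Fin n → ℚ} {g : Fin m → ℤ} (h : ∀ j, f (c j) = g j) :
    f (∑ j, u j • c j) = ((g ⬝ᵥ u : ℤ) : ℚ) := by
  rw [map_sum, dotProduct, Int.cast_sum]
  refine Finset.sum_congr rfl fun j _ => ?_
  rw [map_zsmul, h, zsmul_eq_mul, Int.cast_mul, mul_comm]

/-- The `p`-torsion of the discriminant group embeds into the kernel modulo `p` of a Gram matrix. -/
lemma card_torsion_primaryComponent_discrGrp_le (p : ℕ) [Fact p.Prime]
    {B : LinearMap.BilinForm ℚ (Fin n → ℚ)} (hsymm : B.IsSymm)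
    {S : Submodule ℤ (Fin n → ℚ)} {s : ℕ} {e : Fin s → Fin n → ℚ}
    (hspan : Submodule.span ℤ (Set.range e) = S)
    {M : Matrix (Fin s) (Fin s) ℤ} (hM : ∀ i j, B (e i) (e j) = M i j) :
    Nat.card {t : AddCommGroup.primaryComponent (discrGrp B S) p // p • t = 0} ≤
      Nat.card (ker (M.map (Int.castRingHom (ZMod p))).mulVecLin) := by
  have hp0 : (p : ℚ) ≠ 0 := by exact_mod_cast (Fact.out : p.Prime).ne_zero
  have key : ∀ t : {t : AddCommGroup.primaryComponent (discrGrp B S) p // p • t = 0},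
      ∃ (x : dualLat B S) (u : Fin s → ℤ), discrCls B S x = t.1.1 ∧
        ∑ i, u i • e i = (p : ℤ) • (x : Fin n → ℚ) ∧
        (M.map (Int.castRingHom (ZMod p))).mulVecLin (Int.castRingHom (ZMod p) ∘ u) = 0 := by
    rintro ⟨⟨q, hq⟩, ht⟩
    obtain ⟨x, rfl⟩ := Submodule.mkQ_surjective _ q
    have hpx : (p : ℤ) • (x : Fin n → ℚ) ∈ S := by
      have h0 : p • (S.comap (dualLat B S).subtype).mkQ x = 0 := congrArg Subtype.val ht
      rw [← map_nsmul] at h0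
      simpa using (Submodule.Quotient.mk_eq_zero _).1 h0
    obtain ⟨u, hu⟩ := (Submodule.mem_span_range_iff_exists_fun ℤ).1 (hspan.ge hpx)
    refine ⟨x, u, rfl, hu, funext fun i => ?_⟩
    rw [Matrix.mulVecLin_apply, ← RingHom.map_mulVec]
    obtain ⟨z, hz⟩ := x.2 (e i) (hspan ▸ Submodule.subset_span ⟨i, rfl⟩)
    have hMu : (M.mulVec u) i = p * z := by
      have h1 : B (e i) (∑ j, u j • e j) = ((M.mulVec u) i : ℤ) :=
        LinearMap.apply_sum_zsmul _ u (hM i)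
      have hz' : B (e i) x = z := (hsymm.eq _ _).trans hz
      rw [hu, map_zsmul, hz', zsmul_eq_mul] at h1
      exact_mod_cast h1.symm
    simp [hMu]
  choose x u hx hu hker using key
  refine Nat.card_le_card_of_injective (fun t => (⟨_, hker t⟩ : ker _)) fun t t' htt' => ?_
  have hmod : ∀ i, (p : ℤ) ∣ u t i - u t' i := fun i => by
    have h := congrFun (congrArg Subtype.val htt') i
    rw [← ZMod.intCast_zmod_eq_zero_iff_dvd]
    simpa [sub_eq_zero] using h
  choose w hw using hmod
  have hsub : (x t : Fin n → ℚ) - x t' ∈ S := by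
    have h1 : (p : ℤ) • ((x t : Fin n → ℚ) - x t') = (p : ℤ) • ∑ i, w i • e i := by
      rw [smul_sub, ← hu, ← hu, ← Finset.sum_sub_distrib, Finset.smul_sum]
      exact Finset.sum_congr rfl fun i _ => by rw [← sub_smul, hw, mul_smul]
    rw [smul_right_injective _ (by exact_mod_cast hp0) h1, ← hspan]
    exact sum_mem fun i _ => Submodule.smul_mem _ _ (Submodule.subset_span ⟨i, rfl⟩)
  refine Subtype.ext (Subtype.ext ?_)
  rw [← hx, ← hx]
  exact (Submodule.Quotient.eq _).2 hsub

open scoped Matrix in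
/-- The kernel of `S/pS → L/pL` embeds into the `p`-torsion of the kernel of the extension of `S` by
its primitive hull in `L`. -/
lemma card_ker_le_card_torsion_primaryComponent_extKer (p : ℕ) [Fact p.Prime]
    {B : LinearMap.BilinForm ℚ (Fin n → ℚ)} {S L : Submodule ℤ (Fin n → ℚ)} (hSL : S ≤ L)
    (hlat : IsIntegralLat B L) {s m : ℕ} {e : Fin s → Fin n → ℚ} {c : Fin m → Fin n → ℚ}
    (he : LinearIndependent ℤ e) (hspan : Submodule.span ℤ (Set.range e) = S)
    (hcspan : Submodule.span ℤ (Set.range c) = L)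
    {A : Matrix (Fin s) (Fin m) ℤ} (hA : ∀ i, ∑ j, A i j • c j = e i)
    [Finite (AddCommGroup.primaryComponent (extKer B S
      ((Submodule.span ℚ (S : Set (Fin n → ℚ))).restrictScalars ℤ ⊓ L)) p)] :
    Nat.card (ker (A.map (Int.castRingHom (ZMod p)))ᵀ.mulVecLin) ≤
      Nat.card {t : AddCommGroup.primaryComponent (extKer B S
        ((Submodule.span ℚ (S : Set (Fin n → ℚ))).restrictScalars ℤ ⊓ L)) p // p • t = 0} := by
  have hp0 : (p : ℚ) ≠ 0 := by exact_mod_cast (Fact.out : p.Prime).ne_zero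
  have key : ∀ v : ker (A.map (Int.castRingHom (ZMod p)))ᵀ.mulVecLin,
      ∃ (t : {t : AddCommGroup.primaryComponent (extKer B S
        ((Submodule.span ℚ (S : Set (Fin n → ℚ))).restrictScalars ℤ ⊓ L)) p // p • t = 0})
        (x : dualLat B S) (u : Fin s → ℤ), discrCls B S x = t.1.1.1 ∧
        ∑ i, u i • e i = (p : ℤ) • (x : Fin n → ℚ) ∧ ∀ i, (u i : ZMod p) = v.1 i := by
    rintro ⟨v, hv⟩
    choose u hu using fun i => ZMod.intCast_surjective (v i)
    have hdvd : ∀ j, (p : ℤ) ∣ (Aᵀ *ᵥ u) j := fun j => by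
      rw [← ZMod.intCast_zmod_eq_zero_iff_dvd]
      have h := congrFun (LinearMap.mem_ker.1 hv) j
      rw [← (funext hu : (fun i => (u i : ZMod p)) = v)] at h
      exact (RingHom.map_mulVec (Int.castRingHom (ZMod p)) Aᵀ u j).trans h
    choose w hw using hdvd
    set y : Fin n → ℚ := ∑ j, w j • c j with hy
    have hyL : y ∈ L := by
      rw [← hcspan]
      exact sum_mem fun j _ => Submodule.smul_mem _ _ (Submodule.subset_span ⟨j, rfl⟩)
    have hpy : ∑ i, u i • e i = (p : ℤ) • y := by
      simp_rw [hy, Finset.smul_sum, ← mul_smul, ← hw, ← hA, Finset.smul_sum, Matrix.mulVec,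
        dotProduct, Finset.sum_smul]
      rw [Finset.sum_comm]
      exact Finset.sum_congr rfl fun j _ => Finset.sum_congr rfl fun i _ => by
        rw [← mul_smul, mul_comm, Matrix.transpose_apply]
    have hpyS : (p : ℤ) • y ∈ S := by
      rw [← hpy, ← hspan]
      exact sum_mem fun j _ => Submodule.smul_mem _ _ (Submodule.subset_span ⟨j, rfl⟩)
    have hyspan : y ∈ Submodule.span ℚ (S : Set (Fin n → ℚ)) := by
      have hmem := Submodule.smul_mem (Submodule.span ℚ (S : Set (Fin n → ℚ))) ((p : ℚ)⁻¹)
        (Submodule.subset_span hpyS)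
      rwa [← Int.cast_smul_eq_zsmul ℚ, smul_smul, Int.cast_natCast, inv_mul_cancel₀ hp0,
        one_smul] at hmem
    let x : dualLat B S := ⟨y, fun z hz => hlat y hyL z (hSL hz)⟩
    have hpx : p • discrCls B S x = 0 := by
      rw [← map_nsmul]
      refine (Submodule.Quotient.mk_eq_zero _).2 ?_
      simpa [x] using hpyS
    exact ⟨⟨⟨⟨discrCls B S x, x, ⟨hyspan, hyL⟩, rfl⟩, 1, Subtype.ext (by simpa using hpx)⟩,
      Subtype.ext (Subtype.ext hpx)⟩, x, u, rfl, hpy, hu⟩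
  choose t x u hx hpx hu using key
  refine Nat.card_le_card_of_injective t fun v v' hvv' => ?_
  have hcls : discrCls B S (x v) = discrCls B S (x v') := by rw [hx, hx, hvv']
  have hsub : (x v : Fin n → ℚ) - x v' ∈ Submodule.span ℤ (Set.range e) := by
    rw [hspan]
    exact (Submodule.Quotient.eq (S.comap (dualLat B S).subtype)).1 hcls
  refine Subtype.ext (funext fun i => ?_)
  have hdvd := he.dvd_of_sum_smul_eq (p := p) (u := fun i => u v i - u v' i) hsub (by
    simp only [sub_smul, Finset.sum_sub_distrib, hpx, smul_sub]) i
  rw [← hu, ← hu, ← sub_eq_zero, ← Int.cast_sub]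
  exact (ZMod.intCast_zmod_eq_zero_iff_dvd _ _).2 hdvd

open scoped Matrix in
/-- The Gram matrix of a `p`-unimodular lattice is injective modulo `p`. -/
lemma mulVec_map_eq_zero_of_punimodular (p : ℕ) [Fact p.Prime]
    {B : LinearMap.BilinForm ℚ (Fin n → ℚ)} (hsymm : B.IsSymm)
    {L : Submodule ℤ (Fin n → ℚ)} (hpuni : ∀ x ∈ dualLat B L, (p : ℤ) • x ∈ L → x ∈ L)
    {m : ℕ} {c : Fin m → Fin n → ℚ} (hc : LinearIndependent ℤ c)
    (hcspan : Submodule.span ℤ (Set.range c) = L)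
    {G : Matrix (Fin m) (Fin m) ℤ} (hG : ∀ i j, B (c i) (c j) = G i j)
    (v : Fin m → ZMod p) (hv : G.map (Int.castRingHom (ZMod p)) *ᵥ v = 0) : v = 0 := by
  have hp0 : (p : ℚ) ≠ 0 := by exact_mod_cast (Fact.out : p.Prime).ne_zero
  choose u hu using fun i => ZMod.intCast_surjective (v i)
  have hdvd : ∀ j, (p : ℤ) ∣ (G *ᵥ u) j := fun j => by
    rw [← ZMod.intCast_zmod_eq_zero_iff_dvd]
    have h := congrFun hv j
    rw [← (funext hu : (fun i => (u i : ZMod p)) = v)] at h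
    exact (RingHom.map_mulVec (Int.castRingHom (ZMod p)) G u j).trans h
  set y : Fin n → ℚ := (p : ℚ)⁻¹ • ∑ j, u j • c j with hy
  have hpy : ∑ j, u j • c j = (p : ℤ) • y := by
    rw [hy, ← Int.cast_smul_eq_zsmul ℚ, smul_smul, Int.cast_natCast, mul_inv_cancel₀ hp0, one_smul]
  have hydual : y ∈ dualLat B L := by
    let N : Submodule ℤ (Fin n → ℚ) := dualLat B (Submodule.span ℤ {y})
    have hcN : Submodule.span ℤ (Set.range c) ≤ N := by
      rw [Submodule.span_le]
      rintro _ ⟨i, rfl⟩ z hz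
      obtain ⟨k, rfl⟩ := Submodule.mem_span_singleton.1 hz
      obtain ⟨l, hl⟩ := hdvd i
      refine ⟨k * l, ?_⟩
      have h1 : B (c i) (∑ j, u j • c j) = ((G *ᵥ u) i : ℤ) :=
        LinearMap.apply_sum_zsmul _ u (hG i)
      rw [map_zsmul, hy, map_smul, h1, hl]
      simp [hp0]
    intro z hz
    obtain ⟨k, hk⟩ := hcN (hcspan.ge hz) y (Submodule.mem_span_singleton_self y)
    exact ⟨k, (hsymm.eq _ _).trans hk⟩
  have hyL : y ∈ L := by
    refine hpuni y hydual ?_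
    rw [← hpy, ← hcspan]
    exact sum_mem fun j _ => Submodule.smul_mem _ _ (Submodule.subset_span ⟨j, rfl⟩)
  funext i
  rw [← hu]
  exact (ZMod.intCast_zmod_eq_zero_iff_dvd _ _).2
    (hc.dvd_of_sum_smul_eq (hcspan ▸ hyL) hpy i)

/-- Let `p` be a prime and `L ⊃ S` a `p`-unimodular extension of a
nondegenerate lattice `S` (all realized in `V = ℚⁿ`: `L` is a full lattice on
which the symmetric nondegenerate form `B` is integral, and `L` is `p`-unimodular
in the sense that the `p`-primary part of `L*/L` is trivial; `S ≤ L` is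
nondegenerate).  Let `S̃ = (S ⊗ ℚ) ∩ L` be the primitive hull of `S` in `L` and
`K = S̃/S ⊆ discr S` the kernel of the finite-index extension `S̃ ⊃ S`.  Then
`rank S^⊥ ≥ ℓ_p(discr S) - 2 ℓ_p(K)`, where `S^⊥ = {x ∈ L : B(x,S) = 0}`. -/
theorem stmt_10 (p : ℕ) [Fact p.Prime] {n : ℕ}
    (B : LinearMap.BilinForm ℚ (Fin n → ℚ)) (hsymm : B.IsSymm)
    (hnd : B.Nondegenerate) (S L : Submodule ℤ (Fin n → ℚ)) (hSL : S ≤ L)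
    (hLspan : Submodule.span ℚ (L : Set (Fin n → ℚ)) = ⊤)
    (hlat : IsIntegralLat B L)
    (hSnd : ∀ x ∈ Submodule.span ℚ (S : Set (Fin n → ℚ)),
      (∀ y ∈ S, B x y = 0) → x = 0)
    (hpuni : ∀ x ∈ dualLat B L, (p : ℤ) • x ∈ L → x ∈ L)
    (Stilde : Submodule ℤ (Fin n → ℚ))
    (hSt : Stilde =
      (Submodule.span ℚ (S : Set (Fin n → ℚ))).restrictScalars ℤ ⊓ L) :
    ellp p (discrGrp B S) ≤
      Module.finrank ℚ
          (Submodule.span ℚ ((L ⊓ orthLat B S : Submodule ℤ (Fin n → ℚ)) : Set (Fin n → ℚ)))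
        + 2 * ellp p ↥(extKer B S Stilde) := by
  subst hSt
  have hLfg := hlat.fg hnd hLspan
  have hSfg : S.FG := hLfg.of_le hSL
  obtain ⟨m, c, hc, hcspan⟩ := hLfg.exists_linearIndependent_span_eq
  obtain ⟨s, e, he, hspan⟩ := hSfg.exists_linearIndependent_span_eq
  have hcL : ∀ j, c j ∈ L := fun j => hcspan ▸ Submodule.subset_span ⟨j, rfl⟩
  have heS : ∀ i, e i ∈ S := fun i => hspan ▸ Submodule.subset_span ⟨i, rfl⟩
  choose A hA using fun i => (Submodule.mem_span_range_iff_exists_fun ℤ).1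
    ((hcspan ▸ hSL (heS i) : e i ∈ Submodule.span ℤ (Set.range c)))
  choose G hG using fun i j => hlat (c i) (hcL i) (c j) (hcL j)
  replace hA : ∀ i, ∑ j, (Matrix.of A) i j • c j = e i := hA
  replace hG : ∀ i j, B (c i) (c j) = (Matrix.of G) i j := hG
  generalize Matrix.of A = A at hA
  generalize Matrix.of G = G at hG
  have hM : ∀ i j, B (e i) (e j) = (A * G * A.transpose) i j := fun i j => by
    have h1 : ∀ k, B.flip (e j) (c k) = ((G k ⬝ᵥ A j : ℤ) : ℚ) := fun k => by
      rw [← hA j]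
      exact LinearMap.apply_sum_zsmul (B (c k)) (A j) (hG k)
    have h2 := LinearMap.apply_sum_zsmul (B.flip (e j)) (A i) h1
    rw [hA i] at h2
    refine h2.trans (congrArg Int.cast ?_)
    rw [dotProduct_comm, Matrix.mul_assoc]
    rfl
  have hDfin := finite_primaryComponent_discrGrp p hSfg hSnd
  let K := extKer B S ((Submodule.span ℚ (S : Set (Fin n → ℚ))).restrictScalars ℤ ⊓ L)
  have hKfin : Finite (AddCommGroup.primaryComponent K p) := by
    refine Finite.of_injective (β := AddCommGroup.primaryComponent (discrGrp B S) p)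
      (fun t => ⟨t.1.1, t.2.imp fun k hk => congrArg Subtype.val hk⟩) fun t t' h => ?_
    exact Subtype.ext (Subtype.ext (Subtype.mk.inj h))
  have hD := card_torsion_primaryComponent_discrGrp_le p hsymm hspan hM
  have hKc := card_ker_le_card_torsion_primaryComponent_extKer p hSL hlat he hspan hcspan hA
  rw [← pow_minGen_eq_card_torsion p _ fun a => a.2.imp fun k hk => Subtype.ext hk,
    Module.natCard_eq_pow_finrank (K := ZMod p), Nat.card_zmod,
    Nat.pow_le_pow_iff_right (Fact.out : p.Prime).one_lt] at hD hKc
  have hrank := Matrix.finrank_ker_mul_mul_transpose_le (A.map (Int.castRingHom (ZMod p)))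
    (G.map (Int.castRingHom (ZMod p)))
    (mulVec_map_eq_zero_of_punimodular p hsymm hpuni hc hcspan hG)
  rw [← Matrix.transpose_map, ← Matrix.map_mul, ← Matrix.map_mul] at hrank
  rw [← Matrix.transpose_map] at hKc
  have hm : m ≤ n := by
    simpa using ((LinearIndependent.iff_fractionRing ℤ ℚ).1 hc).fintype_card_le_finrank
  have hperp := le_add_finrank_span_inf_orthLat B hLspan hspan
  simp only [ellp]
  omega
end

section
/- Let F be the free group on d-1 generators (d = 2k ≥ 2) and κ: F → ℤ/2 an epimorphism sending each generator to the nontrivial element. Then the Alexander module A_F = K/[K,K] (K = ker κ), as a ℤ[ℤ/2]-module, is isomorphic to ℤ[ℤ/2]/(t-1) ⊕ (ℤ[ℤ/2])^{d-2}. -/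
/-- The group ring `ℤ[ℤ/2]`. -/
abbrev GrpRing : Type := MonoidAlgebra ℤ (Multiplicative (ZMod 2))

/-- The generator `t` of `ℤ/2` inside `ℤ[ℤ/2]`. -/
noncomputable def tGen : GrpRing :=
  MonoidAlgebra.of ℤ (Multiplicative (ZMod 2)) (Multiplicative.ofAdd 1)

/-- The `ℤ[ℤ/2]`-module `ℤ[ℤ/2]/(t-1) ⊕ (ℤ[ℤ/2])^{d-2}`. -/
abbrev AlexTarget (d : ℕ) : Type :=
  (GrpRing ⧸ Ideal.span {tGen - 1}) × (Fin (d - 2) → GrpRing)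

/-- Multiplication by `t` on `AlexTarget d`. -/
noncomputable def tMul (d : ℕ) (x : AlexTarget d) : AlexTarget d :=
  (Ideal.Quotient.mk (Ideal.span {tGen - 1}) tGen * x.1, fun i => tGen * x.2 i)

/-- The first summand `ℤ[ℤ/2]/(t-1)` of the Alexander module. -/
abbrev TrivialModule : Type := GrpRing ⧸ Ideal.span {tGen - 1}

theorem tGen_mul_self : tGen * tGen = 1 := by
  rw [tGen, ← map_mul, ← ofAdd_add, show (1 + 1 : ZMod 2) = 0 from rfl, ofAdd_zero, map_one]

theorem GrpRing.addSubgroup_eq_top {H : AddSubgroup GrpRing} (h1 : 1 ∈ H) (ht : tGen ∈ H) :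
    H = ⊤ := by
  have hof : ∀ g, MonoidAlgebra.of ℤ (Multiplicative (ZMod 2)) g ∈ H := by
    intro g
    obtain rfl | rfl : g = 1 ∨ g = Multiplicative.ofAdd 1 := by revert g; decide
    · rwa [map_one]
    · exact ht
  refine (AddSubgroup.eq_top_iff' H).2 fun x => ?_
  induction x using MonoidAlgebra.induction_on with
  | of g => exact hof g
  | add x y hx hy => exact H.add_mem hx hy
  | smul n x hx => exact H.zsmul_mem hx n

theorem TrivialModule.mk_tGen : Ideal.Quotient.mk (Ideal.span {tGen - 1}) tGen = 1 := by
  rw [← map_one (Ideal.Quotient.mk (Ideal.span {tGen - 1}))]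
  exact Ideal.Quotient.eq.2 (Ideal.subset_span rfl)

theorem TrivialModule.addSubgroup_eq_top {H : AddSubgroup TrivialModule} (h1 : 1 ∈ H) :
    H = ⊤ := by
  have h : H.comap (Ideal.Quotient.mk (Ideal.span {tGen - 1})).toAddMonoidHom = ⊤ :=
    GrpRing.addSubgroup_eq_top (by simpa using h1)
      (by simpa [TrivialModule.mk_tGen] using h1)
  refine (AddSubgroup.eq_top_iff' H).2 fun x => ?_
  obtain ⟨r, rfl⟩ := Ideal.Quotient.mk_surjective x
  exact (AddSubgroup.eq_top_iff' _).1 h r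

theorem addSubgroup_prod_eq_top {ι : Type*} [Fintype ι] [DecidableEq ι]
    {H : AddSubgroup (TrivialModule × (ι → GrpRing))} (h0 : (1, 0) ∈ H)
    (h1 : ∀ i, (0, Pi.single i 1) ∈ H) (ht : ∀ i, (0, Pi.single i tGen) ∈ H) : H = ⊤ := by
  have hl : H.comap (AddMonoidHom.inl TrivialModule (ι → GrpRing)) = ⊤ :=
    TrivialModule.addSubgroup_eq_top h0
  have hr (i : ι) : H.comap ((AddMonoidHom.inr TrivialModule (ι → GrpRing)).comp
      (AddMonoidHom.single (fun _ => GrpRing) i)) = ⊤ :=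
    GrpRing.addSubgroup_eq_top (h1 i) (ht i)
  refine (AddSubgroup.eq_top_iff' H).2 fun ⟨x, v⟩ => ?_
  have hv : AddMonoidHom.inr TrivialModule (ι → GrpRing) v ∈ H := by
    rw [← Finset.univ_sum_single v, map_sum]
    exact H.sum_mem fun i _ => (AddSubgroup.eq_top_iff' _).1 (hr i) (v i)
  simpa using H.add_mem ((AddSubgroup.eq_top_iff' _).1 hl x) hv

theorem GrpRing.exists_addMonoidHom {B : Type*} [AddCommGroup B] (b c : B) :
    ∃ f : GrpRing →+ B, f 1 = b ∧ f tGen = c := by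
  let φ : GrpRing →+ B := (Finsupp.liftAddHom fun g : Multiplicative (ZMod 2) =>
    (zmultiplesHom B (if g = 1 then b else c))).comp
      MonoidAlgebra.coeffAddEquiv.toAddMonoidHom
  refine ⟨φ, ?_, ?_⟩
  · simp [φ, MonoidAlgebra.one_def]
  · simp [φ, tGen]

theorem TrivialModule.exists_addMonoidHom {B : Type*} [AddCommGroup B] (z : B) :
    ∃ f : TrivialModule →+ B, f 1 = z := by
  let ε : GrpRing →+* ℤ := (MonoidAlgebra.lift ℤ ℤ (Multiplicative (ZMod 2)) 1).toRingHom
  have hε : ∀ a ∈ Ideal.span {tGen - 1}, ε a = 0 := by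
    intro a ha
    have : Ideal.span {tGen - 1} ≤ RingHom.ker ε := by
      rw [Ideal.span_singleton_le_iff_mem, RingHom.mem_ker]
      simp [ε, tGen]
    exact this ha
  exact ⟨(zmultiplesHom B z).comp (Ideal.Quotient.lift _ ε hε).toAddMonoidHom, by simp⟩

theorem exists_addMonoidHom_prod {ι : Type*} [Fintype ι] [DecidableEq ι] {B : Type*}
    [AddCommGroup B] (z : B) (b c : ι → B) :
    ∃ f : TrivialModule × (ι → GrpRing) →+ B, f (1, 0) = z ∧
      (∀ i, f (0, Pi.single i 1) = b i) ∧ ∀ i, f (0, Pi.single i tGen) = c i := by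
  obtain ⟨f₀, h₀⟩ := TrivialModule.exists_addMonoidHom z
  choose g hg₁ hgt using fun i => GrpRing.exists_addMonoidHom (b i) (c i)
  have hsum (i : ι) (r : GrpRing) : ∑ j, g j ((Pi.single i r : ι → GrpRing) j) = g i r := by
    rw [Finset.sum_eq_single i (fun j _ hj => by simp [hj]) (by simp), Pi.single_eq_same]
  refine ⟨f₀.coprod (∑ i, (g i).comp (Pi.evalAddMonoidHom _ i)), ?_, ?_, ?_⟩ <;>
    simp [AddMonoidHom.finsetSum_apply, hsum, h₀, hg₁, hgt]

/-- The affine permutation `v ↦ t v + δ`. -/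
noncomputable def affinePerm {ι : Type*} (δ : ι → GrpRing) : Equiv.Perm (ι → GrpRing) where
  toFun v := tGen • v + δ
  invFun v := tGen • (v - δ)
  left_inv v := by simp [smul_smul, tGen_mul_self]
  right_inv v := by simp [smul_smul, tGen_mul_self]

/-- The affine action of the free group whose translation parts are the Fox derivatives: it sends
`x₀` to `v ↦ t v` and `xᵢ₊₁` to `v ↦ t v + eᵢ`. -/
noncomputable def foxAction (m : ℕ) : FreeGroup (Fin (m + 1)) →* Equiv.Perm (Fin m → GrpRing) :=
  FreeGroup.lift fun i => affinePerm
    ((Fin.cons 0 (fun j => Pi.single j 1) : Fin (m + 1) → Fin m → GrpRing) i)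

theorem foxAction_of_zero {m : ℕ} (v : Fin m → GrpRing) :
    foxAction m (FreeGroup.of 0) v = tGen • v := by
  simp [foxAction, affinePerm]

theorem foxAction_of_succ {m : ℕ} (i : Fin m) (v : Fin m → GrpRing) :
    foxAction m (FreeGroup.of i.succ) v = tGen • v + Pi.single i 1 := by
  simp [foxAction, affinePerm]

theorem foxAction_of_zero_inv {m : ℕ} (v : Fin m → GrpRing) :
    foxAction m (FreeGroup.of 0)⁻¹ v = tGen • v := by
  rw [map_inv, Equiv.Perm.inv_eq_iff_eq, foxAction_of_zero, smul_smul, tGen_mul_self, one_smul]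

/-- The total exponent homomorphism of a free group. -/
def totalExponent (α : Type*) : FreeGroup α →* Multiplicative ℤ :=
  FreeGroup.lift fun _ => Multiplicative.ofAdd 1

section Kernel

variable {m : ℕ} {κ : FreeGroup (Fin (m + 1)) →* Multiplicative (ZMod 2)}

theorem foxAction_apply (hκ : ∀ i, κ (FreeGroup.of i) = Multiplicative.ofAdd 1)
    (w : FreeGroup (Fin (m + 1))) (v : Fin m → GrpRing) :
    foxAction m w v =
      MonoidAlgebra.of ℤ (Multiplicative (ZMod 2)) (κ w) • v + foxAction m w 0 := by
  induction w using FreeGroup.induction_on generalizing v with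
  | C1 => simp only [map_one, one_smul, Equiv.Perm.one_apply, add_zero]
  | of i => simp [foxAction, affinePerm, hκ, tGen]
  | inv_of i _ =>
    have h : (Multiplicative.ofAdd (1 : ZMod 2))⁻¹ = Multiplicative.ofAdd 1 := rfl
    rw [map_inv κ, hκ, h, ← tGen]
    simp [foxAction, affinePerm, Equiv.Perm.inv_def, sub_eq_add_neg]
  | mul x y hx hy =>
    rw [map_mul, Equiv.Perm.mul_apply, Equiv.Perm.mul_apply, hy, hx,
      hx (foxAction m y 0), map_mul, map_mul, smul_add, smul_smul, add_assoc]

theorem foxAction_apply_of_mem_ker (hκ : ∀ i, κ (FreeGroup.of i) = Multiplicative.ofAdd 1)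
    {w : FreeGroup (Fin (m + 1))} (hw : w ∈ κ.ker) (v : Fin m → GrpRing) :
    foxAction m w v = v + foxAction m w 0 := by
  rw [foxAction_apply hκ, MonoidHom.mem_ker.1 hw, map_one, one_smul]

theorem foxAction_conj (hκ : ∀ i, κ (FreeGroup.of i) = Multiplicative.ofAdd 1)
    {s w : FreeGroup (Fin (m + 1))} (hs : κ s = Multiplicative.ofAdd 1) (hw : w ∈ κ.ker) :
    foxAction m (s⁻¹ * w * s) 0 = tGen • foxAction m w 0 := by
  rw [map_mul, map_mul, map_inv, Equiv.Perm.mul_apply, Equiv.Perm.mul_apply,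
    Equiv.Perm.inv_eq_iff_eq, foxAction_apply_of_mem_ker hκ hw,
    foxAction_apply hκ s (tGen • _), hs, ← tGen, smul_smul, tGen_mul_self, one_smul, add_comm]

theorem two_dvd_totalExponent (hκ : ∀ i, κ (FreeGroup.of i) = Multiplicative.ofAdd 1)
    {w : FreeGroup (Fin (m + 1))} (hw : w ∈ κ.ker) :
    2 ∣ (totalExponent _ w).toAdd := by
  have h : κ = (AddMonoidHom.toMultiplicative (Int.castAddHom (ZMod 2))).comp
      (totalExponent (Fin (m + 1))) := by
    ext i
    simp [hκ, totalExponent]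
  rw [h] at hw
  exact (ZMod.intCast_zmod_eq_zero_iff_dvd _ 2).1 hw

/-- The Fox derivatives together with half the total exponent, as a homomorphism on the kernel. -/
noncomputable def foxHom (hκ : ∀ i, κ (FreeGroup.of i) = Multiplicative.ofAdd 1) :
    κ.ker →* Multiplicative (TrivialModule × (Fin m → GrpRing)) where
  toFun w := Multiplicative.ofAdd
    ((((totalExponent _ (w : FreeGroup (Fin (m + 1)))).toAdd / 2 : ℤ) : TrivialModule),
      foxAction m w 0)
  map_one' := by simp
  map_mul' x y := by
    rw [← ofAdd_add, Prod.mk_add_mk]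
    congr 2
    · rw [Subgroup.coe_mul, map_mul, toAdd_mul,
        Int.add_ediv_of_dvd_left (two_dvd_totalExponent hκ x.2), Int.cast_add]
    · rw [Subgroup.coe_mul, map_mul, Equiv.Perm.mul_apply, foxAction_apply_of_mem_ker hκ x.2,
        add_comm]

/-- A subgroup of `κ.ker` containing the Reidemeister–Schreier generators is everything. -/
theorem subgroup_ker_eq_top (hκ : ∀ i, κ (FreeGroup.of i) = Multiplicative.ofAdd 1)
    {N : Subgroup κ.ker}
    (h0 : ∀ h, (⟨FreeGroup.of 0 * FreeGroup.of 0, h⟩ : κ.ker) ∈ N)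
    (h1 : ∀ (i : Fin m) h, (⟨FreeGroup.of i.succ * (FreeGroup.of 0)⁻¹, h⟩ : κ.ker) ∈ N)
    (h2 : ∀ (i : Fin m) h, (⟨(FreeGroup.of 0)⁻¹ * FreeGroup.of i.succ, h⟩ : κ.ker) ∈ N) :
    N = ⊤ := by
  set x : FreeGroup (Fin (m + 1)) := FreeGroup.of 0 with hx
  set H := N.map κ.ker.subtype with hH
  have mem {w : FreeGroup (Fin (m + 1))} (hw : w ∈ κ.ker) (h : ∀ h, (⟨w, h⟩ : κ.ker) ∈ N) :
      w ∈ H := ⟨⟨w, hw⟩, h hw, rfl⟩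
  have hxx : x * x ∈ H := mem (by rw [MonoidHom.mem_ker, map_mul, hκ]; rfl) h0
  have hl (i : Fin (m + 1)) : FreeGroup.of i * x⁻¹ ∈ H := by
    cases i using Fin.cases with
    | zero => simp [hx]
    | succ i => exact mem (by rw [MonoidHom.mem_ker, map_mul, map_inv, hκ, hκ]; rfl) (h1 i)
  have hr (i : Fin (m + 1)) : x⁻¹ * FreeGroup.of i ∈ H := by
    cases i using Fin.cases with
    | zero => simp [hx]
    | succ i => exact mem (by rw [MonoidHom.mem_ker, map_mul, map_inv, hκ, hκ]; rfl) (h2 i)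
  let P (g : FreeGroup (Fin (m + 1))) : Prop :=
    (∀ w ∈ H, x⁻¹ * (g * w) ∈ H) ∧ ∀ w ∈ H, g * (x * w) ∈ H
  have hP (i : Fin (m + 1)) : P (FreeGroup.of i) := by
    refine ⟨fun w hw => ?_, fun w hw => ?_⟩
    · rw [← mul_assoc]
      exact H.mul_mem (hr i) hw
    · convert H.mul_mem (H.mul_mem (hl i) hxx) hw using 1
      group
  have hP' (i : Fin (m + 1)) : P (FreeGroup.of i)⁻¹ := by
    refine ⟨fun w hw => ?_, fun w hw => ?_⟩
    · convert H.mul_mem (H.mul_mem (H.inv_mem hxx) (H.inv_mem (hl i))) hw using 1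
      group
    · convert H.mul_mem (H.inv_mem (hr i)) hw using 1
      group
  have key (g : FreeGroup (Fin (m + 1))) :
      ∀ w, w ∈ H ∨ x⁻¹ * w ∈ H → g * w ∈ H ∨ x⁻¹ * (g * w) ∈ H := by
    have step {g : FreeGroup (Fin (m + 1))} (hg : P g) (w : FreeGroup (Fin (m + 1)))
        (hw : w ∈ H ∨ x⁻¹ * w ∈ H) : g * w ∈ H ∨ x⁻¹ * (g * w) ∈ H :=
      hw.elim (fun h => .inr (hg.1 w h)) fun h => .inl (by simpa using hg.2 _ h)
    induction g using FreeGroup.induction_on with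
    | C1 => simp
    | of i => exact step (hP i)
    | inv_of i _ => exact step (hP' i)
    | mul a b ha hb =>
      intro w hw
      simpa only [mul_assoc] using ha _ (hb _ hw)
  refine (Subgroup.eq_top_iff' N).2 fun ⟨g, hg⟩ => ?_
  have hgH : g ∈ H := by
    have h := key g 1 (.inl H.one_mem)
    rw [mul_one] at h
    refine h.resolve_right fun h => ?_
    have hk : κ (x⁻¹ * g) = 1 := by
      obtain ⟨y, -, hy⟩ := h
      rw [← hy]
      exact y.2
    rw [map_mul, map_inv, hκ, MonoidHom.mem_ker.1 hg] at hk
    exact absurd hk (by decide)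
  obtain ⟨y, hy, rfl⟩ := hgH
  exact hy

theorem bijective_lift_foxHom (hκ : ∀ i, κ (FreeGroup.of i) = Multiplicative.ofAdd 1) :
    Function.Bijective (Abelianization.lift (foxHom hκ)) := by
  have m0 : FreeGroup.of 0 * FreeGroup.of 0 ∈ κ.ker := by
    rw [MonoidHom.mem_ker, map_mul, hκ]; rfl
  have m1 (i : Fin m) : FreeGroup.of i.succ * (FreeGroup.of 0)⁻¹ ∈ κ.ker := by
    rw [MonoidHom.mem_ker, map_mul, map_inv, hκ, hκ]; rfl
  have m2 (i : Fin m) : (FreeGroup.of 0)⁻¹ * FreeGroup.of i.succ ∈ κ.ker := by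
    rw [MonoidHom.mem_ker, map_mul, map_inv, hκ, hκ]; rfl
  have f0 : foxHom hκ ⟨_, m0⟩ = Multiplicative.ofAdd (1, 0) := by
    simp [foxHom, totalExponent, foxAction_of_zero]
  have f1 (i : Fin m) : foxHom hκ ⟨_, m1 i⟩ = Multiplicative.ofAdd (0, Pi.single i 1) := by
    simp only [foxHom, MonoidHom.coe_mk, OneHom.coe_mk]
    rw [map_mul (foxAction m), Equiv.Perm.mul_apply, foxAction_of_zero_inv, foxAction_of_succ]
    simp [totalExponent]
  have f2 (i : Fin m) : foxHom hκ ⟨_, m2 i⟩ = Multiplicative.ofAdd (0, Pi.single i tGen) := by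
    simp only [foxHom, MonoidHom.coe_mk, OneHom.coe_mk]
    rw [map_mul (foxAction m), Equiv.Perm.mul_apply, foxAction_of_succ, foxAction_of_zero_inv]
    simp [totalExponent, ← Pi.single_smul]
  constructor
  · obtain ⟨ψ, hψ0, hψ1, hψ2⟩ := exists_addMonoidHom_prod
      (B := Additive (Abelianization κ.ker)) (.ofMul (.of ⟨_, m0⟩))
      (fun i => .ofMul (.of ⟨_, m1 i⟩)) (fun i => .ofMul (.of ⟨_, m2 i⟩))
    let ψ' := AddMonoidHom.toMultiplicativeLeft ψ
    have hN : MonoidHom.eqLocus (ψ'.comp (foxHom hκ)) Abelianization.of = ⊤ := by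
      refine subgroup_ker_eq_top hκ (fun _ => ?_) (fun i _ => ?_) fun i _ => ?_
      · exact (congrArg ψ' f0).trans hψ0
      · exact (congrArg ψ' (f1 i)).trans (hψ1 i)
      · exact (congrArg ψ' (f2 i)).trans (hψ2 i)
    refine Function.LeftInverse.injective (g := ψ') fun a => ?_
    obtain ⟨x, rfl⟩ := QuotientGroup.mk_surjective a
    exact (Subgroup.eq_top_iff' _).1 hN x
  · have hR : (AddMonoidHom.range (MonoidHom.toAdditiveLeft
        (Abelianization.lift (foxHom hκ)))) = ⊤ :=
      addSubgroup_prod_eq_top ⟨.ofMul (.of ⟨_, m0⟩), f0⟩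
        (fun i => ⟨.ofMul (.of ⟨_, m1 i⟩), f1 i⟩) fun i => ⟨.ofMul (.of ⟨_, m2 i⟩), f2 i⟩
    exact AddMonoidHom.range_eq_top.1 hR

theorem foxHom_conj (hκ : ∀ i, κ (FreeGroup.of i) = Multiplicative.ofAdd 1)
    {s : FreeGroup (Fin (m + 1))} (hs : κ s = Multiplicative.ofAdd 1) {x y : κ.ker}
    (hy : (y : FreeGroup (Fin (m + 1))) = s⁻¹ * x * s) :
    foxHom hκ y = Multiplicative.ofAdd (tMul (m + 2) (foxHom hκ x).toAdd) := by
  refine congrArg Multiplicative.ofAdd (Prod.ext ?_ ?_)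
  · simp [tMul, foxHom, hy, TrivialModule.mk_tGen]
  · exact (congrArg (foxAction m · 0) hy).trans (foxAction_conj hκ hs x.2)

end Kernel

/-- Let `F` be the free group on `d-1` generators (`d = 2k ≥ 2`)
and `κ : F → ℤ/2` the epimorphism sending each generator to the nontrivial
element.  Then the Alexander module `A_F = K/[K,K]` (`K = ker κ`, with `ℤ/2`
acting by conjugation by a lift `t̄`) is isomorphic, as a `ℤ[ℤ/2]`-module, to
`ℤ[ℤ/2]/(t-1) ⊕ (ℤ[ℤ/2])^{d-2}`: there is a group isomorphism intertwining the
conjugation action with multiplication by `t`. -/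
theorem stmt_15 (k : ℕ) (hk : 1 ≤ k) (d : ℕ) (hd : d = 2 * k)
    (κ : FreeGroup (Fin (d - 1)) →* Multiplicative (ZMod 2))
    (hκ : ∀ i, κ (FreeGroup.of i) = Multiplicative.ofAdd 1)
    (tbar : FreeGroup (Fin (d - 1))) (htbar : κ tbar = Multiplicative.ofAdd 1)
    (T : ↥κ.ker ≃* ↥κ.ker)
    (hT : ∀ x : ↥κ.ker, (T x : FreeGroup (Fin (d - 1))) = tbar⁻¹ * ↑x * tbar)
    (tAct : Abelianization ↥κ.ker →* Abelianization ↥κ.ker)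
    (htAct : ∀ x : ↥κ.ker, tAct (Abelianization.of x) = Abelianization.of (T x)) :
    ∃ e : Abelianization ↥κ.ker ≃* Multiplicative (AlexTarget d),
      ∀ a, e (tAct a) = Multiplicative.ofAdd (tMul d (Multiplicative.toAdd (e a))) := by
  obtain ⟨m, rfl⟩ : ∃ m, d = m + 2 := ⟨d - 2, by omega⟩
  refine ⟨MulEquiv.ofBijective _ (bijective_lift_foxHom hκ), fun a => ?_⟩
  obtain ⟨x, rfl⟩ := QuotientGroup.mk_surjective a
  exact (congrArg (Abelianization.lift (foxHom hκ)) (htAct x)).trans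
    (foxHom_conj hκ htbar (hT x))
end
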